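/- Under assumptions (A1)–(A4), let c be the unique fixed point of f₀∘f₁ in [1−x₀, y₀] (so in particular c ∈ (1−x₀, x₀)). Then for every h ∈ (0, 1/2) and every ρ > 0 there exist a natural number n₁ and δ > 0 such that ℙ_x({ω ∈ Σ : f^{n₁}_ω(x) ∈ (c−ρ, c+ρ)}) ≥ δ for every x ∈ [h, 1−h]. -/

import Mathlib

/-
Formalization of the Alsedà–Misiurewicz system setup:
`f0, f1` are the piecewise-linear interval homeomorphisms, `iter` the random
iteration along ω ∈ Σ = {0,1}^ℕ, `IsKernel` characterises the family x ↦ ℙ_x by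
its values on cylinder sets, `Pop` is the Markov operator (as a set function),
`Stationary` expresses P-invariance for probability measures on (0,1), `U` is
the dual operator, and `A1`–`A4` are the assumptions of the paper.
-/

open MeasureTheory Filter Set
open scoped ENNReal Topology

namespace AM

noncomputable def f0 (x₀ y₀ : ℝ) (x : ℝ) : ℝ :=
  if x ≤ x₀ then (y₀ / x₀) * x else ((1 - y₀) / (1 - x₀)) * (x - 1) + 1

noncomputable def f1 (x₀ y₀ : ℝ) (x : ℝ) : ℝ := 1 - f0 x₀ y₀ (1 - x)

/-- `fb b` is `f₁` if `b = true`, and `f₀` if `b = false`. -/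
noncomputable def fb (x₀ y₀ : ℝ) (b : Bool) : ℝ → ℝ :=
  if b then f1 x₀ y₀ else f0 x₀ y₀

/-- `iter x₀ y₀ ω n x = f^n_ω(x) = f_{ω (n-1)} ∘ ⋯ ∘ f_{ω 0} (x)`, with `f^0_ω = id`. -/
noncomputable def iter (x₀ y₀ : ℝ) (ω : ℕ → Bool) : ℕ → ℝ → ℝ
  | 0, x => x
  | n + 1, x => fb x₀ y₀ (ω n) (iter x₀ y₀ ω n x)

/-- `cylProb x₀ y₀ p₀ p₁ x w = p_{i₁}(x) p_{i₂}(f_{i₁} x) ⋯` for the word `w = (i₁, …, i_k)`. -/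
noncomputable def cylProb (x₀ y₀ : ℝ) (p₀ p₁ : ℝ → ℝ) : ℝ → List Bool → ℝ
  | _, [] => 1
  | x, b :: w => (if b then p₁ x else p₀ x) * cylProb x₀ y₀ p₀ p₁ (fb x₀ y₀ b x) w

/-- The cylinder set of sequences starting with the word `w`. -/
def cyl (w : List Bool) : Set (ℕ → Bool) := {ω | ∀ j : Fin w.length, ω j = w.get j}

/-- `IsKernel x₀ y₀ p₀ p₁ Pm` says that `Pm x = ℙ_x` for all `x ∈ (0,1)`, i.e. `Pm x` gives
every cylinder set its prescribed probability (this determines `Pm x` uniquely and makes it a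
probability measure, since the empty word gives `Pm x univ = 1`). -/
def IsKernel (x₀ y₀ : ℝ) (p₀ p₁ : ℝ → ℝ) (Pm : ℝ → Measure (ℕ → Bool)) : Prop :=
  ∀ x ∈ Ioo (0:ℝ) 1, ∀ w : List Bool,
    Pm x (cyl w) = ENNReal.ofReal (cylProb x₀ y₀ p₀ p₁ x w)

/-- The Markov operator `P`, as a set function:
`Pop μ A = ∫_{f₀⁻¹(A)} p₀ dμ + ∫_{f₁⁻¹(A)} p₁ dμ`. -/
noncomputable def Pop (x₀ y₀ : ℝ) (p₀ p₁ : ℝ → ℝ) (μ : Measure ℝ) (A : Set ℝ) : ℝ≥0∞ :=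
  (∫⁻ x in f0 x₀ y₀ ⁻¹' A, ENNReal.ofReal (p₀ x) ∂μ) +
    ∫⁻ x in f1 x₀ y₀ ⁻¹' A, ENNReal.ofReal (p₁ x) ∂μ

/-- A stationary (P-invariant) Borel probability measure on (0,1). -/
def Stationary (x₀ y₀ : ℝ) (p₀ p₁ : ℝ → ℝ) (μ : Measure ℝ) : Prop :=
  IsProbabilityMeasure μ ∧ μ (Ioo 0 1) = 1 ∧
    ∀ A : Set ℝ, MeasurableSet A → A ⊆ Ioo 0 1 → μ A = Pop x₀ y₀ p₀ p₁ μ A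

/-- The dual operator `Uφ(x) = p₀(x) φ(f₀ x) + p₁(x) φ(f₁ x)`. -/
noncomputable def U (x₀ y₀ : ℝ) (p₀ p₁ : ℝ → ℝ) (φ : ℝ → ℝ) : ℝ → ℝ :=
  fun x => p₀ x * φ (f0 x₀ y₀ x) + p₁ x * φ (f1 x₀ y₀ x)

/-- Assumption (A1): `1/2 < x₀ < 1` and `1/2 ≤ y₀ < x₀`. -/
def A1 (x₀ y₀ : ℝ) : Prop := 1/2 < x₀ ∧ x₀ < 1 ∧ 1/2 ≤ y₀ ∧ y₀ < x₀

/-- Assumption (A2): Dini continuity of `p₀, p₁`; `β` is a modulus of continuity for both, with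
`∑ₙ β(C tⁿ) < ∞` for all `C ≥ 0`, `0 < t < 1`. (Such a `β` exists iff the least modulus of
continuity has this summability property.) -/
def A2 (p₀ p₁ : ℝ → ℝ) : Prop :=
  ∃ β : ℝ → ℝ,
    (∀ t : ℝ, ∀ x ∈ Icc (0:ℝ) 1, ∀ y ∈ Icc (0:ℝ) 1, |x - y| ≤ t →
      |p₀ x - p₀ y| ≤ β t ∧ |p₁ x - p₁ y| ≤ β t) ∧
    (∀ C : ℝ, 0 ≤ C → ∀ t : ℝ, 0 < t → t < 1 → Summable fun n : ℕ => β (C * t ^ n))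

/-- Assumption (A3): `p₀, p₁` are continuous, `p₀ + p₁ = 1`, and `0 < pᵢ < 1` on `[0,1]`. -/
def A3 (p₀ p₁ : ℝ → ℝ) : Prop :=
  ContinuousOn p₀ (Icc 0 1) ∧ ContinuousOn p₁ (Icc 0 1) ∧
    ∀ x ∈ Icc (0:ℝ) 1, p₀ x + p₁ x = 1 ∧ 0 < p₀ x ∧ p₀ x < 1 ∧ 0 < p₁ x ∧ p₁ x < 1

/-- Assumption (A4): the average Lyapunov exponents at 0 and 1 are positive
(`a₀ = y₀/x₀`, `a₁ = (1-y₀)/(1-x₀)`). -/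
def A4 (x₀ y₀ : ℝ) (p₀ p₁ : ℝ → ℝ) : Prop :=
  0 < p₀ 0 * Real.log (y₀ / x₀) + p₁ 0 * Real.log ((1 - y₀) / (1 - x₀)) ∧
    0 < p₀ 1 * Real.log ((1 - y₀) / (1 - x₀)) + p₁ 1 * Real.log (y₀ / x₀)

end AM

namespace AM

/-- The state after applying the letters of `w` to `x`, the head of `w` first. -/
noncomputable def run (x₀ y₀ : ℝ) (w : List Bool) (x : ℝ) : ℝ :=
  w.foldl (fun z b => fb x₀ y₀ b z) x

/-- `y` can be reached from `x` by some word of length `n`. -/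
def Reach (x₀ y₀ : ℝ) (n : ℕ) (x y : ℝ) : Prop :=
  ∃ w : List Bool, w.length = n ∧ run x₀ y₀ w x = y

section

variable {x₀ y₀ : ℝ}

lemma run_append (w v : List Bool) (x : ℝ) :
    run x₀ y₀ (w ++ v) x = run x₀ y₀ v (run x₀ y₀ w x) := List.foldl_append

lemma Reach.refl (x : ℝ) : Reach x₀ y₀ 0 x x := ⟨[], rfl, rfl⟩

lemma Reach.trans {m n : ℕ} {x y z : ℝ} (h : Reach x₀ y₀ m x y) (h' : Reach x₀ y₀ n y z) :
    Reach x₀ y₀ (m + n) x z := by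
  obtain ⟨w, rfl, rfl⟩ := h
  obtain ⟨v, rfl, rfl⟩ := h'
  exact ⟨w ++ v, List.length_append, run_append w v x⟩

lemma reach_f0 (x : ℝ) : Reach x₀ y₀ 1 x (f0 x₀ y₀ x) := ⟨[false], rfl, by simp [run, fb]⟩

lemma reach_f1 (x : ℝ) : Reach x₀ y₀ 1 x (f1 x₀ y₀ x) := ⟨[true], rfl, by simp [run, fb]⟩

lemma iter_eq_run {w : List Bool} {ω : ℕ → Bool} (hω : ω ∈ cyl w) (x : ℝ) :
    iter x₀ y₀ ω w.length x = run x₀ y₀ w x := by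
  induction w using List.reverseRecOn with
  | nil => rfl
  | append_singleton w b ih =>
    have hw : ω ∈ cyl w := fun j => by
      have := hω ⟨j, by simp⟩
      simpa [List.getElem_append_left] using this
    have hb : ω w.length = b := by
      have := hω ⟨w.length, by simp⟩
      simpa using this
    rw [run_append, ← ih hw]
    simp [iter, hb, run]

lemma A1.bounds (h : A1 x₀ y₀) :
    0 < y₀ / x₀ ∧ y₀ / x₀ < 1 ∧ 1 < (1 - y₀) / (1 - x₀) ∧
      1 < y₀ / x₀ * ((1 - y₀) / (1 - x₀)) := by
  obtain ⟨h1, h2, h3, h4⟩ := h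
  refine ⟨by apply div_pos <;> linarith, ?_, ?_, ?_⟩
  · rw [div_lt_one (by linarith)]; exact h4
  · rw [one_lt_div (by linarith)]; linarith
  · rw [div_mul_div_comm, one_lt_div (mul_pos (by linarith) (by linarith))]
    nlinarith

lemma f0_of_le {x : ℝ} (hx : x ≤ x₀) : f0 x₀ y₀ x = y₀ / x₀ * x := if_pos hx

lemma f0_of_lt {x : ℝ} (hx : x₀ < x) :
    f0 x₀ y₀ x = (1 - y₀) / (1 - x₀) * (x - 1) + 1 := if_neg hx.not_ge

lemma f1_of_ge {x : ℝ} (hx : 1 - x₀ ≤ x) : f1 x₀ y₀ x = 1 - y₀ / x₀ * (1 - x) := by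
  rw [f1, f0_of_le (by linarith)]

lemma f1_of_le (h : A1 x₀ y₀) {x : ℝ} (hx : x ≤ 1 - x₀) :
    f1 x₀ y₀ x = (1 - y₀) / (1 - x₀) * x := by
  obtain ⟨h1, h2, h3, h4⟩ := h
  rcases hx.lt_or_eq with hx | rfl
  · rw [f1, f0_of_lt (by linarith)]; ring
  · rw [f1_of_ge le_rfl]
    have : x₀ ≠ 0 := by linarith
    have : 1 - x₀ ≠ 0 := by linarith
    field_simp
    ring

lemma continuous_f0 (h : A1 x₀ y₀) : Continuous (f0 x₀ y₀) := by
  obtain ⟨h1, h2, h3, h4⟩ := h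
  refine Continuous.if_le (by fun_prop) (by fun_prop) continuous_id continuous_const ?_
  rintro x rfl
  have : id x ≠ 0 := by simp only [id]; linarith
  have : 1 - id x ≠ 0 := by simp only [id]; linarith
  simp only [id] at *
  field_simp
  ring

lemma continuous_fb (h : A1 x₀ y₀) (b : Bool) : Continuous (fb x₀ y₀ b) := by
  have h0 := continuous_f0 h
  have h1 : Continuous (f1 x₀ y₀) := by unfold f1; fun_prop
  cases b <;> simpa [fb]

lemma continuous_run (h : A1 x₀ y₀) (w : List Bool) : Continuous (run x₀ y₀ w) := by
  induction w with
  | nil => exact continuous_id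
  | cons b w ih => exact ih.comp (continuous_fb h b)

lemma f0_mem_Icc (h : A1 x₀ y₀) {x : ℝ} (hx : x ∈ Icc (0 : ℝ) 1) :
    f0 x₀ y₀ x ∈ Icc (0 : ℝ) 1 := by
  obtain ⟨ha, ha', hb, -⟩ := h.bounds
  obtain ⟨h1, h2, h3, h4⟩ := h
  obtain ⟨hx0, hx1⟩ := hx
  rcases le_or_gt x x₀ with hx | hx
  · rw [f0_of_le hx]
    exact ⟨by positivity, mul_le_one₀ ha'.le hx0 hx1⟩
  · rw [f0_of_lt hx]
    have : (1 - y₀) / (1 - x₀) * (1 - x) ≤ (1 - y₀) / (1 - x₀) * (1 - x₀) := by gcongr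
    rw [div_mul_cancel₀ _ (by linarith)] at this
    have : 0 ≤ (1 - y₀) / (1 - x₀) * (1 - x) := mul_nonneg (by linarith) (by linarith)
    constructor <;> linarith

lemma fb_mem_Icc (h : A1 x₀ y₀) (b : Bool) {x : ℝ} (hx : x ∈ Icc (0 : ℝ) 1) :
    fb x₀ y₀ b x ∈ Icc (0 : ℝ) 1 := by
  cases b
  · exact f0_mem_Icc h hx
  · have := f0_mem_Icc h (x := 1 - x) ⟨by linarith [hx.2], by linarith [hx.1]⟩
    exact ⟨by simpa [fb, f1] using this.2, by simpa [fb, f1] using this.1⟩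

lemma pow_le_cylProb (h : A1 x₀ y₀) {p₀ p₁ : ℝ → ℝ} {ε : ℝ} (hε : 0 < ε)
    (hp : ∀ x ∈ Icc (0 : ℝ) 1, ε ≤ p₀ x ∧ ε ≤ p₁ x) (w : List Bool) {x : ℝ}
    (hx : x ∈ Icc (0 : ℝ) 1) : ε ^ w.length ≤ cylProb x₀ y₀ p₀ p₁ x w := by
  induction w generalizing x with
  | nil => simp [cylProb]
  | cons b w ih =>
    rw [List.length_cons, pow_succ', cylProb]
    have hb : ε ≤ if b then p₁ x else p₀ x := by split_ifs <;> simp [hp x hx]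
    exact mul_le_mul hb (ih (fb_mem_Icc h b hx)) (by positivity) (hε.le.trans hb)

lemma A3.exists_lower_bound {p₀ p₁ : ℝ → ℝ} (h : A3 p₀ p₁) :
    ∃ ε > 0, ∀ x ∈ Icc (0 : ℝ) 1, ε ≤ p₀ x ∧ ε ≤ p₁ x := by
  obtain ⟨h0, h1, hp⟩ := h
  have hne : (Icc (0 : ℝ) 1).Nonempty := ⟨0, by simp⟩
  obtain ⟨u, hu, hu'⟩ := isCompact_Icc.exists_isMinOn hne h0
  obtain ⟨v, hv, hv'⟩ := isCompact_Icc.exists_isMinOn hne h1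
  exact ⟨min (p₀ u) (p₁ v), lt_min (hp u hu).2.1 (hp v hv).2.2.2.1, fun x hx =>
    ⟨(min_le_left _ _).trans (hu' hx), (min_le_right _ _).trans (hv' hx)⟩⟩

/-- While the orbit stays below `1 - y₀`, the map `f₁` acts by multiplication. -/
lemma reach_mul_pow (h : A1 x₀ y₀) (m : ℕ) {u : ℝ}
    (hm : ((1 - y₀) / (1 - x₀)) ^ m * u ≤ 1 - y₀) :
    Reach x₀ y₀ m u (((1 - y₀) / (1 - x₀)) ^ m * u) := by
  obtain ⟨-, -, hb, -⟩ := h.bounds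
  have hx : 0 < 1 - x₀ := by linarith [h.2.1]
  have hba : (1 - y₀) / (1 - x₀) * (1 - x₀) = 1 - y₀ := div_mul_cancel₀ _ hx.ne'
  induction m with
  | zero => simpa using Reach.refl u
  | succ m ih =>
    rw [pow_succ', mul_assoc] at hm ⊢
    have hle : ((1 - y₀) / (1 - x₀)) ^ m * u ≤ 1 - x₀ :=
      le_of_mul_le_mul_left (hm.trans hba.ge) (by linarith)
    have := (ih (by linarith [h.2.2.2])).trans (reach_f1 _)
    rwa [f1_of_le h hle] at this

lemma exists_reach_le_x₀ (h : A1 x₀ y₀) {x : ℝ} (hx0 : 0 < x) (hx1 : x < 1) :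
    ∃ k u, Reach x₀ y₀ k x u ∧ 0 < u ∧ u ≤ x₀ := by
  obtain ⟨-, -, hb, -⟩ := h.bounds
  have hx := h.2.1
  have hx' := h.1
  by_contra! hcon
  have key : ∀ k : ℕ, ∃ u, Reach x₀ y₀ k x u ∧ 0 < u ∧
      ((1 - y₀) / (1 - x₀)) ^ k * (1 - x) = 1 - u := by
    intro k
    induction k with
    | zero => exact ⟨x, Reach.refl x, hx0, by simp⟩
    | succ k ih =>
      obtain ⟨u, hu, hu0, he⟩ := ih
      have hlt := hcon k u hu hu0
      have hf := f0_of_lt (y₀ := y₀) hlt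
      refine ⟨_, hu.trans (reach_f0 u), ?_, ?_⟩
      · have : (1 - y₀) / (1 - x₀) * (1 - u) < (1 - y₀) / (1 - x₀) * (1 - x₀) := by gcongr
        rw [div_mul_cancel₀ _ (by linarith)] at this
        rw [hf]
        linarith [h.2.2.1]
      · rw [pow_succ', mul_assoc, he, hf]; ring
  obtain ⟨k, hk⟩ := pow_unbounded_of_one_lt (1 / (1 - x)) hb
  rw [div_lt_iff₀ (by linarith)] at hk
  obtain ⟨u, -, hu, he⟩ := key k
  linarith

lemma exists_reach_le (h : A1 x₀ y₀) {x : ℝ} (hx0 : 0 < x) (hx1 : x < 1) :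
    ∃ k u, Reach x₀ y₀ k x u ∧ 0 < u ∧ u ≤ 1 - x₀ := by
  obtain ⟨ha, ha', -, -⟩ := h.bounds
  obtain ⟨k, u, hu, hu0, hux⟩ := exists_reach_le_x₀ h hx0 hx1
  have key : ∀ j : ℕ, Reach x₀ y₀ j u ((y₀ / x₀) ^ j * u) := by
    intro j
    induction j with
    | zero => simpa using Reach.refl u
    | succ j ih =>
      have hle : (y₀ / x₀) ^ j * u ≤ x₀ :=
        (mul_le_of_le_one_left hu0.le (pow_le_one₀ ha.le ha'.le)).trans hux
      have := ih.trans (reach_f0 _)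
      rwa [f0_of_le hle, ← mul_assoc, ← pow_succ'] at this
  obtain ⟨j, hj⟩ := exists_pow_lt_of_lt_one (sub_pos.2 h.2.1) ha'
  refine ⟨k + j, _, hu.trans (key j), by positivity, ?_⟩
  have : (y₀ / x₀) ^ j * u ≤ (y₀ / x₀) ^ j := mul_le_of_le_one_right (by positivity)
    (hux.trans h.2.1.le)
  linarith

lemma exists_reach_even (h : A1 x₀ y₀) {x : ℝ} (hx0 : 0 < x) (hx1 : x < 1) :
    ∃ n y, Reach x₀ y₀ (2 * n) x y ∧ 1 - x₀ < y ∧ y ≤ 1 - y₀ := by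
  obtain ⟨ha, ha', hb, hab⟩ := h.bounds
  set a := y₀ / x₀ with hadef
  set b := (1 - y₀) / (1 - x₀) with hbdef
  have hx : 0 < 1 - x₀ := by linarith [h.2.1]
  have hba : b * (1 - x₀) = 1 - y₀ := div_mul_cancel₀ _ hx.ne'
  by_contra! hcon
  have hodd : ∀ n y, Reach x₀ y₀ n x y → 1 - x₀ < y → y ≤ 1 - y₀ → Odd n := by
    intro n y hr h1 h2
    by_contra hn
    obtain ⟨r, rfl⟩ := (Nat.not_odd_iff_even.1 hn).two_dvd
    exact absurd h2 (hcon r y hr h1).not_ge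
  have key : ∀ j : ℕ, ∃ k m u, Reach x₀ y₀ k x u ∧ 0 < u ∧ 1 - x₀ < b ^ m * u ∧
      b ^ m * u ≤ 1 - y₀ ∧ (a * b) ^ j * (1 - x₀) ≤ b ^ m * u := by
    intro j
    induction j with
    | zero =>
      obtain ⟨k, u, hu, hu0, hux⟩ := exists_reach_le h hx0 hx1
      obtain ⟨m, hm, hm'⟩ := exists_nat_pow_near ((one_le_div hu0).2 hux) hb
      rw [le_div_iff₀ hu0] at hm
      rw [div_lt_iff₀ hu0] at hm'
      refine ⟨k, m + 1, u, hu, hu0, hm', ?_, by simpa using hm'.le⟩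
      rw [pow_succ', mul_assoc, ← hba]
      gcongr
    | succ j ih =>
      obtain ⟨k, m, u, hu, hu0, h1, h2, h3⟩ := ih
      have hub : u ≤ b ^ m * u := le_mul_of_one_le_left hu0.le (one_le_pow₀ hb.le)
      have hau : Reach x₀ y₀ (k + 1) x (a * u) := by
        have := hu.trans (reach_f0 u)
        rwa [f0_of_le (by linarith [h.1, h.2.2.1])] at this
      have hcomm : b ^ m * (a * u) = a * (b ^ m * u) := by ring
      have hle : a * (b ^ m * u) ≤ b ^ m * u := mul_le_of_le_one_left (by positivity) ha'.le
      have hle' : a * (b ^ m * u) ≤ 1 - x₀ := by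
        by_contra! hlt
        have o1 := hodd _ _ (hu.trans (reach_mul_pow h m h2)) h1 h2
        have hr := hau.trans (reach_mul_pow h m (hcomm ▸ hle.trans h2))
        have o2 := hodd _ _ hr (hcomm ▸ hlt) (hcomm ▸ hle.trans h2)
        grind
      have he : b ^ (m + 1) * (a * u) = a * b * (b ^ m * u) := by ring
      refine ⟨k + 1, m + 1, a * u, hau, by positivity, ?_, ?_, ?_⟩
      · rw [he]; nlinarith
      · have : b * (a * (b ^ m * u)) ≤ b * (1 - x₀) := by gcongr
        linarith
      · rw [he, pow_succ', mul_assoc]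
        gcongr
  obtain ⟨j, hj⟩ := pow_unbounded_of_one_lt ((1 - y₀) / (1 - x₀)) hab
  rw [div_lt_iff₀ hx] at hj
  obtain ⟨k, m, u, -, -, -, h2, h3⟩ := key j
  linarith

/-- An open interval containing `[1 - y₀, y₀]` which `f₀ ∘ f₁` maps into itself affinely. -/
def trap (x₀ y₀ : ℝ) : Set ℝ := Ioo (1 - x₀) (1 - x₀ * (1 - x₀) / y₀)

lemma lt_trap_right (h : A1 x₀ y₀) : y₀ < 1 - x₀ * (1 - x₀) / y₀ := by
  obtain ⟨h1, h2, h3, h4⟩ := h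
  rw [lt_sub_comm, div_lt_iff₀ (by linarith)]
  nlinarith

lemma f0_f1_of_mem_trap (h : A1 x₀ y₀) {z : ℝ} (hz : z ∈ trap x₀ y₀) :
    f0 x₀ y₀ (f1 x₀ y₀ z) = y₀ / x₀ * (1 - y₀ / x₀ * (1 - z)) ∧
      f0 x₀ y₀ (f1 x₀ y₀ z) ∈ trap x₀ y₀ := by
  obtain ⟨ha, ha', hb, hab⟩ := h.bounds
  have hq := lt_trap_right h
  obtain ⟨h1, h2, h3, h4⟩ := h
  obtain ⟨hz1, hz2⟩ := hz
  have hx : 0 < x₀ := by linarith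
  have hy : 0 < y₀ := by linarith
  have hf1 : f1 x₀ y₀ z < x₀ := by
    rw [f1_of_ge hz1.le]
    have : y₀ / x₀ * (x₀ * (1 - x₀) / y₀) < y₀ / x₀ * (1 - z) := by gcongr; linarith
    have e : y₀ / x₀ * (x₀ * (1 - x₀) / y₀) = 1 - x₀ := by field_simp
    linarith
  have he : f0 x₀ y₀ (f1 x₀ y₀ z) = y₀ / x₀ * (1 - y₀ / x₀ * (1 - z)) := by
    rw [f0_of_le hf1.le, f1_of_ge hz1.le]
  refine ⟨he, ?_, ?_⟩
  · rw [he]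
    have hax : y₀ / x₀ * x₀ = y₀ := div_mul_cancel₀ _ hx.ne'
    have : y₀ / x₀ * (1 - z) < y₀ / x₀ * x₀ := by gcongr; linarith
    have h5 : y₀ / x₀ * (1 - y₀) < y₀ / x₀ * (1 - y₀ / x₀ * (1 - z)) := by gcongr; linarith
    rw [← mul_div_assoc, one_lt_div (by linarith)] at hab
    linarith
  · rw [f0_of_le hf1.le]
    have : y₀ / x₀ * f1 x₀ y₀ z < y₀ / x₀ * x₀ := by gcongr
    rw [div_mul_cancel₀ _ hx.ne'] at this
    linarith

lemma reach_contract (h : A1 x₀ y₀) {c : ℝ} (hc : c ∈ trap x₀ y₀)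
    (hfix : f0 x₀ y₀ (f1 x₀ y₀ c) = c) {z : ℝ} (hz : z ∈ trap x₀ y₀) (M : ℕ) :
    ∃ y ∈ trap x₀ y₀, Reach x₀ y₀ (2 * M) z y ∧ y - c = ((y₀ / x₀) ^ 2) ^ M * (z - c) := by
  induction M with
  | zero => exact ⟨z, hz, Reach.refl z, by simp⟩
  | succ M ih =>
    obtain ⟨y, hy, hr, he⟩ := ih
    obtain ⟨e1, h1⟩ := f0_f1_of_mem_trap h hy
    have e2 := (f0_f1_of_mem_trap h hc).1
    refine ⟨_, h1, hr.trans ((reach_f1 y).trans (reach_f0 _)), ?_⟩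
    rw [pow_succ', mul_assoc, ← he, e1]
    linear_combination hfix - e2

lemma exists_uniform_reach (h : A1 x₀ y₀) {c : ℝ} (hc : c ∈ Ioo (1 - x₀) y₀)
    (hfix : f0 x₀ y₀ (f1 x₀ y₀ c) = c) {K : Set ℝ} (hK : IsCompact K) (hK' : K ⊆ Ioo 0 1)
    {ρ : ℝ} (hρ : 0 < ρ) :
    ∃ n, ∀ x ∈ K, ∃ y ∈ Ioo (c - ρ) (c + ρ), Reach x₀ y₀ n x y := by
  obtain ⟨ha, ha', -, -⟩ := h.bounds
  have hq := lt_trap_right h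
  have hc' : c ∈ trap x₀ y₀ := ⟨hc.1, hc.2.trans hq⟩
  let V : ℕ → Set ℝ := fun n => ⋃ w : {w : List Bool // w.length = 2 * n},
    run x₀ y₀ w ⁻¹' trap x₀ y₀
  have hV : ∀ {n x}, x ∈ V n ↔ ∃ y ∈ trap x₀ y₀, Reach x₀ y₀ (2 * n) x y := by
    intro n x
    simp only [V, Reach, mem_iUnion, mem_preimage, Subtype.exists]
    exact ⟨fun ⟨w, hw, hm⟩ => ⟨_, hm, w, hw, rfl⟩, fun ⟨y, hy, w, hw, e⟩ => ⟨w, hw, e ▸ hy⟩⟩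
  have hmono : Monotone V := by
    refine monotone_nat_of_le_succ fun n x hx => ?_
    obtain ⟨y, hy, hr⟩ := hV.1 hx
    obtain ⟨z, hz, hr', -⟩ := reach_contract h hc' hfix hy 1
    exact hV.2 ⟨z, hz, hr.trans hr'⟩
  obtain ⟨n, hn⟩ := hK.elim_directed_cover V
    (fun n => isOpen_iUnion fun w => isOpen_Ioo.preimage (continuous_run h w))
    (fun x hx => by
      obtain ⟨n, y, hr, h1, h2⟩ := exists_reach_even h (hK' hx).1 (hK' hx).2
      exact mem_iUnion.2 ⟨n, hV.2 ⟨y, ⟨h1, by linarith [h.2.2.1]⟩, hr⟩⟩)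
    hmono.directed_le
  obtain ⟨M, hM⟩ := exists_pow_lt_of_lt_one hρ (pow_lt_one₀ ha.le ha' two_ne_zero)
  refine ⟨2 * n + 2 * M, fun x hx => ?_⟩
  obtain ⟨y, hy, hr⟩ := hV.1 (hn hx)
  obtain ⟨z, -, hr', he⟩ := reach_contract h hc' hfix hy M
  refine ⟨z, ?_, hr.trans hr'⟩
  have hbd : ∀ t ∈ trap x₀ y₀, 0 ≤ t ∧ t ≤ 1 := by
    intro t ht
    obtain ⟨h1, h2, h3, h4⟩ := h
    have : 0 ≤ x₀ * (1 - x₀) / y₀ :=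
      div_nonneg (mul_nonneg (by linarith) (by linarith)) (by linarith)
    exact ⟨by linarith [ht.1], by linarith [ht.2]⟩
  have hy1 : |y - c| ≤ 1 := abs_sub_le_iff.2
    ⟨by linarith [hbd y hy, hbd c hc'], by linarith [hbd y hy, hbd c hc']⟩
  have hz : |z - c| < ρ := by
    rw [he, abs_mul, abs_of_nonneg (by positivity)]
    exact (mul_le_of_le_one_right (by positivity) hy1).trans_lt hM
  rw [abs_lt] at hz
  exact ⟨by linarith, by linarith⟩

end

end AM

/-- Lemma 4: with `c` the unique fixed point of `f₀ ∘ f₁` in `[1−x₀, y₀]`, for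
every `h ∈ (0, 1/2)` and `ρ > 0` there are `n₁ ∈ ℕ` and `δ > 0` with
`ℙ_x(f^(n₁)_ω(x) ∈ (c−ρ, c+ρ)) ≥ δ` for every `x ∈ [h, 1−h]`. -/
theorem stmt12 (x₀ y₀ : ℝ) (p₀ p₁ : ℝ → ℝ)
    (hA1 : AM.A1 x₀ y₀) (hA2 : AM.A2 p₀ p₁) (hA3 : AM.A3 p₀ p₁) (hA4 : AM.A4 x₀ y₀ p₀ p₁)
    (Pm : ℝ → MeasureTheory.Measure (ℕ → Bool)) (hPm : AM.IsKernel x₀ y₀ p₀ p₁ Pm)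
    (c : ℝ) (hc : c ∈ Set.Ioo (1 - x₀) y₀) (hfix : AM.f0 x₀ y₀ (AM.f1 x₀ y₀ c) = c)
    (huniq : ∀ c' ∈ Set.Icc (1 - x₀) y₀, AM.f0 x₀ y₀ (AM.f1 x₀ y₀ c') = c' → c' = c) :
    ∀ h : ℝ, 0 < h → h < 1/2 → ∀ ρ : ℝ, 0 < ρ →
      ∃ n₁ : ℕ, ∃ δ : ℝ, 0 < δ ∧
        ∀ x ∈ Set.Icc h (1 - h),
          ENNReal.ofReal δ ≤
            Pm x {ω : ℕ → Bool | AM.iter x₀ y₀ ω n₁ x ∈ Set.Ioo (c - ρ) (c + ρ)} := by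
  intro h hh hh' ρ hρ
  obtain ⟨ε, hε, hp⟩ := hA3.exists_lower_bound
  obtain ⟨n, hn⟩ := AM.exists_uniform_reach hA1 hc hfix (K := Icc h (1 - h)) isCompact_Icc
    (fun x hx => ⟨by linarith [hx.1], by linarith [hx.2]⟩) hρ
  refine ⟨n, ε ^ n, by positivity, fun x hx => ?_⟩
  obtain ⟨y, hy, w, rfl, rfl⟩ := hn x hx
  have hx' : x ∈ Ioo (0 : ℝ) 1 := ⟨by linarith [hx.1], by linarith [hx.2]⟩
  calc ENNReal.ofReal (ε ^ w.length)
      ≤ ENNReal.ofReal (AM.cylProb x₀ y₀ p₀ p₁ x w) :=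
        ENNReal.ofReal_le_ofReal (AM.pow_le_cylProb hA1 hε hp w (Ioo_subset_Icc_self hx'))
    _ = Pm x (AM.cyl w) := (hPm x hx' w).symm
    _ ≤ _ := measure_mono fun ω hω => by
        rw [mem_ofPred_eq, AM.iter_eq_run hω]
        exact hy
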